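/- Let e be a positive integer, E a complex Hilbert space, A = (A_1,…,A_g) a g-tuple of bounded operators on E, W = (W_α)_α a family of bounded linear maps W_α : ℂ^e → E indexed by words α in g letters, and G = (G_α)_α a family of matrices G_α ∈ M_e(ℂ) with G_∅ = 0. Then the following are equivalent: (i) the coefficient identities hold, namely for all words α, β and all 1 ≤ j,k ≤ g: W_β^* A_k^* W_{x_jα} + W_{x_kβ}^* A_j W_α + W_{x_kβ}^* W_{x_jα} = 0, W_∅^*(A_k W_α + W_{x_kα}) = G_{x_kα}, and W_∅^* W_∅ = I; (ii) for every n and every jointly nilpotent tuple X ∈ M_n(ℂ)^g, the identity I + G(X) + G(X)^* = W(X)^* L_A(X) W(X) holds, where all sums involved are finite because X is jointly nilpotent. -/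

import Mathlib

open scoped Kronecker Matrix
open ContinuousLinearMap (adjoint)

/-- The product of matrices from the tuple `X` along the word `α` (empty word ↦ identity). -/
noncomputable def wordProd {g n : ℕ} (X : Fin g → Matrix (Fin n) (Fin n) ℂ)
    (α : List (Fin g)) : Matrix (Fin n) (Fin n) ℂ :=
  (α.map X).prod

/-- `G(X) = Σ_α G_α ⊗ X^α` (a finite sum when `X` is jointly nilpotent). -/
noncomputable def GEval {g e n : ℕ} (G : List (Fin g) → Matrix (Fin e) (Fin e) ℂ)
    (X : Fin g → Matrix (Fin n) (Fin n) ℂ) : Matrix (Fin e × Fin n) (Fin e × Fin n) ℂ :=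
  ∑ᶠ α : List (Fin g), (G α) ⊗ₖ wordProd X α

/-- The `(a,i)` block of `W(X) = Σ_α W_α ⊗ X^α`, namely `Σ_α (X^α)_{a,i} • W_α`
(a finite sum when `X` is jointly nilpotent). -/
noncomputable def WXblk {g e : ℕ} {E : Type*} [NormedAddCommGroup E]
    [InnerProductSpace ℂ E]
    (W : List (Fin g) → (EuclideanSpace ℂ (Fin e) →L[ℂ] E))
    {n : ℕ} (X : Fin g → Matrix (Fin n) (Fin n) ℂ) (a i : Fin n) :
    EuclideanSpace ℂ (Fin e) →L[ℂ] E :=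
  ∑ᶠ α : List (Fin g), (wordProd X α a i) • W α

/-- The `(a,b)` block of the pencil `L_A(X)` acting on `E^n`:
`δ_{ab}·Id + Σ_j (X_j)_{ab} A_j + Σ_j conj((X_j)_{ba}) A_j^*`. -/
noncomputable def LAblk {g : ℕ} {E : Type*} [NormedAddCommGroup E]
    [InnerProductSpace ℂ E] [CompleteSpace E] (A : Fin g → (E →L[ℂ] E))
    {n : ℕ} (X : Fin g → Matrix (Fin n) (Fin n) ℂ) (a b : Fin n) : E →L[ℂ] E :=
  (if a = b then 1 else 0) + ∑ j : Fin g, (X j a b) • A j +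
    ∑ j : Fin g, (starRingEnd ℂ) (X j b a) • adjoint (A j)

section WordSums

variable {g : ℕ}

/-- The finite set of words of length at most `N`. -/
noncomputable def wordsUpTo (g N : ℕ) : Finset (List (Fin g)) :=
  (List.finite_length_lt (Fin g) (N + 1)).toFinset

@[simp] lemma mem_wordsUpTo {N : ℕ} {α : List (Fin g)} :
    α ∈ wordsUpTo g N ↔ α.length ≤ N := by
  simp [wordsUpTo]

/-- Splitting off the first letter in a sum over words. -/
lemma sum_wordsUpTo_eq {M : Type*} [AddCommMonoid M] {N : ℕ} (F : List (Fin g) → M)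
    (hF : ∀ α, N < α.length → F α = 0) :
    ∑ α ∈ wordsUpTo g N, F α = F [] + ∑ j, ∑ α ∈ wordsUpTo g N, F (j :: α) := by
  classical
  have hinj : Set.InjOn (fun p : Fin g × List (Fin g) => p.1 :: p.2)
      (Finset.univ ×ˢ wordsUpTo g N : Finset (Fin g × List (Fin g))) := by
    rintro ⟨j, α⟩ - ⟨k, β⟩ - h
    simpa using h
  rw [← Finset.sum_product' Finset.univ (wordsUpTo g N) fun j α => F (j :: α),
    ← Finset.sum_image (f := F) hinj, ← Finset.sum_insert (by simp)]
  refine Finset.sum_subset (fun α hα => ?_) fun α _ hα => hF α (by simpa using hα)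
  cases α with
  | nil => simp
  | cons j α =>
    have : α.length ≤ N := by simp at hα; omega
    simp [this]

lemma sum_wordsUpTo_smul {R M : Type*} [Semiring R] [AddCommMonoid M] [Module R M] {N : ℕ}
    (c : List (Fin g) → R) (T : List (Fin g) → M) (hc : ∀ α, N < α.length → c α = 0)
    (hT : T [] = 0) :
    ∑ α ∈ wordsUpTo g N, c α • T α =
      ∑ α ∈ wordsUpTo g N, ∑ j, c (j :: α) • T (j :: α) := by
  rw [sum_wordsUpTo_eq _ fun α hα => by rw [hc α hα, zero_smul], hT, smul_zero, zero_add,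
    Finset.sum_comm]

end WordSums

section Words

variable {g n : ℕ}

@[simp] lemma wordProd_nil (X : Fin g → Matrix (Fin n) (Fin n) ℂ) : wordProd X [] = 1 := by
  simp [wordProd]

lemma wordProd_cons (X : Fin g → Matrix (Fin n) (Fin n) ℂ) (j : Fin g) (α : List (Fin g)) :
    wordProd X (j :: α) = X j * wordProd X α := by
  simp [wordProd]

/-- The scalar `((X^β)^* X^α)_{il}`. -/
noncomputable def wordGram (X : Fin g → Matrix (Fin n) (Fin n) ℂ) (i l : Fin n)
    (β α : List (Fin g)) : ℂ :=
  ((wordProd X β)ᴴ * wordProd X α) i l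

lemma wordGram_nil_left (X : Fin g → Matrix (Fin n) (Fin n) ℂ) (i l : Fin n)
    (α : List (Fin g)) : wordGram X i l [] α = wordProd X α i l := by
  simp [wordGram]

lemma wordGram_nil_right (X : Fin g → Matrix (Fin n) (Fin n) ℂ) (i l : Fin n)
    (β : List (Fin g)) : wordGram X i l β [] = (starRingEnd ℂ) (wordProd X β l i) := by
  simp [wordGram]

lemma wordGram_apply (X : Fin g → Matrix (Fin n) (Fin n) ℂ) (i l : Fin n)
    (β α : List (Fin g)) :
    wordGram X i l β α =
      ∑ a, (starRingEnd ℂ) (wordProd X β a i) * wordProd X α a l := by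
  simp [wordGram, Matrix.mul_apply]

lemma wordGram_cons_right (X : Fin g → Matrix (Fin n) (Fin n) ℂ) (i l : Fin n) (j : Fin g)
    (β α : List (Fin g)) :
    wordGram X i l β (j :: α) =
      ∑ a, ∑ b, (starRingEnd ℂ) (wordProd X β a i) * (X j a b * wordProd X α b l) := by
  simp [wordGram_apply, wordProd_cons, Matrix.mul_apply, Finset.mul_sum]

lemma wordGram_cons_left (X : Fin g → Matrix (Fin n) (Fin n) ℂ) (i l : Fin n) (k : Fin g)
    (β α : List (Fin g)) :
    wordGram X i l (k :: β) α =
      ∑ a, ∑ b, (starRingEnd ℂ) (wordProd X β a i) *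
        ((starRingEnd ℂ) (X k b a) * wordProd X α b l) := by
  simp only [wordGram_apply, wordProd_cons, Matrix.mul_apply, map_sum, map_mul,
    Finset.sum_mul]
  rw [Finset.sum_comm]
  exact Finset.sum_congr rfl fun a _ => Finset.sum_congr rfl fun b _ => by ring

end Words

section Chain

variable {g : ℕ}

/-- Two chains of basis vectors, spelling `β` from index `0` and `α` from the last index,
glued at their common end point `β.length`. -/
def chainTuple (β α : List (Fin g)) (j : Fin g) :
    Matrix (Fin (β.length + α.length + 1)) (Fin (β.length + α.length + 1)) ℂ :=
  Matrix.of fun u v =>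
    if (v.val < β.length ∧ u.val = v.val + 1 ∧ β[β.length - u.val]? = some j) ∨
      (β.length < v.val ∧ v.val = u.val + 1 ∧ α[u.val - β.length]? = some j) then 1 else 0

lemma wordProd_chainTuple_ne_zero (β α γ : List (Fin g))
    (u v : Fin (β.length + α.length + 1)) (h : wordProd (chainTuple β α) γ u v ≠ 0) :
    (v.val - β.length) + (β.length - v.val) =
      (u.val - β.length) + (β.length - u.val) + γ.length := by
  induction γ generalizing u with
  | nil =>
    have : u = v := by
      by_contra huv
      exact h (by simp [huv])
    simp [this]
  | cons j γ ih =>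
    rw [wordProd_cons, Matrix.mul_apply] at h
    obtain ⟨w, -, hw⟩ := Finset.exists_ne_zero_of_sum_ne_zero h
    have h1 := ih w (right_ne_zero_of_mul hw)
    have h2 := left_ne_zero_of_mul hw
    simp only [chainTuple, Matrix.of_apply, ne_eq, ite_eq_right_iff, one_ne_zero, imp_false,
      not_not] at h2
    simp only [List.length_cons]
    omega

lemma wordProd_chainTuple_eq_zero (β α γ : List (Fin g))
    (h : β.length + α.length < γ.length) : wordProd (chainTuple β α) γ = 0 := by
  ext u v
  by_contra hne
  have := wordProd_chainTuple_ne_zero β α γ u v hne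
  omega

lemma cons_eq_drop_iff {T : Type*} (l γ : List T) (j : T) (m : ℕ) :
    j :: γ = l.drop m ↔ l[m]? = some j ∧ γ = l.drop (m + 1) := by
  by_cases hm : m < l.length
  · rw [List.drop_eq_getElem_cons hm, List.getElem?_eq_getElem hm]
    rw [List.cons.injEq, Option.some_inj, eq_comm (a := j)]
  · rw [List.drop_eq_nil_of_le (by omega), List.getElem?_eq_none (by omega)]
    simp

lemma wordProd_chainTuple_zero (β α γ : List (Fin g)) (u : Fin (β.length + α.length + 1)) :
    wordProd (chainTuple β α) γ u 0 =
      if u.val ≤ β.length ∧ γ = β.drop (β.length - u.val) then 1 else 0 := by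
  induction γ generalizing u with
  | nil =>
    rw [wordProd_nil, Matrix.one_apply]
    refine if_congr ?_ rfl rfl
    rw [eq_comm (a := []), List.drop_eq_nil_iff, Fin.ext_iff, Fin.val_zero]
    omega
  | cons j γ ih =>
    rw [wordProd_cons, Matrix.mul_apply]
    simp only [ih, chainTuple, Matrix.of_apply, cons_eq_drop_iff]
    by_cases hu : 0 < u.val ∧ u.val ≤ β.length
    · rw [Finset.sum_eq_single ⟨u.val - 1, by omega⟩]
      · have e1 : β.length - (u.val - 1) = β.length - u.val + 1 := by omega
        have e2 : u.val - 1 < β.length := by omega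
        have e3 : u.val - 1 ≤ β.length := by omega
        have e4 : u.val = u.val - 1 + 1 := by omega
        have e5 : ¬ (β.length < u.val - 1) := by omega
        simp only [e1, e2, e3, ← e4, e5, hu.2, true_and, false_and, or_false, ite_and]
        split_ifs <;> simp
      · intro v _ hv
        have hv' : v.val ≠ u.val - 1 := fun h => hv (Fin.ext h)
        split_ifs <;> first | omega | simp
      · simp
    · rw [Finset.sum_eq_zero, if_neg]
      · rintro ⟨h1, h2, h3⟩
        have := (List.getElem?_eq_some_iff.mp h2).1
        omega
      · intro v _
        split_ifs <;> first | omega | simp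

lemma wordProd_chainTuple_last (β α γ : List (Fin g)) (u : Fin (β.length + α.length + 1)) :
    wordProd (chainTuple β α) γ u (Fin.last _) =
      if β.length ≤ u.val ∧ γ = α.drop (u.val - β.length) then 1 else 0 := by
  induction γ generalizing u with
  | nil =>
    rw [wordProd_nil, Matrix.one_apply]
    refine if_congr ?_ rfl rfl
    rw [eq_comm (a := []), List.drop_eq_nil_iff, Fin.ext_iff, Fin.val_last]
    omega
  | cons j γ ih =>
    rw [wordProd_cons, Matrix.mul_apply]
    simp only [ih, chainTuple, Matrix.of_apply, cons_eq_drop_iff]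
    by_cases hu : β.length ≤ u.val ∧ u.val < β.length + α.length
    · rw [Finset.sum_eq_single ⟨u.val + 1, by omega⟩]
      · have e1 : u.val + 1 - β.length = u.val - β.length + 1 := by omega
        have e2 : β.length < u.val + 1 := by omega
        have e3 : β.length ≤ u.val + 1 := by omega
        have e5 : ¬ (u.val + 1 < β.length) := by omega
        simp only [e1, e2, e3, e5, hu.1, true_and, false_and, false_or, ite_and]
        split_ifs <;> simp
      · intro v _ hv
        have hv' : v.val ≠ u.val + 1 := fun h => hv (Fin.ext h)
        split_ifs <;> first | omega | simp
      · simp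
    · rw [Finset.sum_eq_zero, if_neg]
      · rintro ⟨h1, h2, h3⟩
        have := (List.getElem?_eq_some_iff.mp h2).1
        omega
      · intro v _
        have := v.isLt
        split_ifs <;> first | omega | simp

lemma wordGram_chainTuple (β α β' α' : List (Fin g)) :
    wordGram (chainTuple β α) 0 (Fin.last _) β' α' = if β' = β ∧ α' = α then 1 else 0 := by
  rw [wordGram_apply, Finset.sum_eq_single ⟨β.length, by omega⟩]
  · simp [wordProd_chainTuple_zero, wordProd_chainTuple_last, ← ite_and, and_comm]
  · intro v _ hv
    have hv' : v.val ≠ β.length := fun h => hv (Fin.ext h)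
    rw [wordProd_chainTuple_zero, wordProd_chainTuple_last]
    split_ifs <;> first | omega | simp
  · simp

lemma sum_wordGram_chainTuple_smul {M : Type*} [AddCommMonoid M] [Module ℂ M]
    (β α : List (Fin g)) (T : List (Fin g) → List (Fin g) → M) :
    ∑ β' ∈ wordsUpTo g (β.length + α.length), ∑ α' ∈ wordsUpTo g (β.length + α.length),
      wordGram (chainTuple β α) 0 (Fin.last _) β' α' • T β' α' = T β α := by
  rw [Finset.sum_eq_single_of_mem β (by simp), Finset.sum_eq_single_of_mem α (by simp)]
  · simp [wordGram_chainTuple]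
  · intro α' _ h
    simp [wordGram_chainTuple, h]
  · intro β' _ h
    simp [wordGram_chainTuple, h]

end Chain

section Sums

variable {ι κ M : Type*} [AddCommMonoid M]

lemma sum_sum_sum_smul {κ' R : Type*} [Semiring R] [Module R M] [Fintype ι] [Fintype κ]
    [Fintype κ'] (s : ι → κ → κ' → R) (T : κ' → M) :
    ∑ a, ∑ b, ∑ j, s a b j • T j = ∑ j, (∑ a, ∑ b, s a b j) • T j := by
  simp only [Finset.sum_smul]
  rw [Finset.sum_comm (s := Finset.univ (α := κ'))]
  exact Finset.sum_congr rfl fun a _ => Finset.sum_comm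

lemma sum_sum_sum_sum_comm [Fintype ι] {S : Finset κ} (f : ι → ι → κ → κ → M) :
    ∑ a, ∑ b, ∑ β ∈ S, ∑ α ∈ S, f a b β α = ∑ β ∈ S, ∑ α ∈ S, ∑ a, ∑ b, f a b β α := by
  have h : ∀ a, ∑ b, ∑ β ∈ S, ∑ α ∈ S, f a b β α = ∑ β ∈ S, ∑ α ∈ S, ∑ b, f a b β α := by
    intro a
    rw [Finset.sum_comm]
    exact Finset.sum_congr rfl fun β _ => Finset.sum_comm
  simp only [h]
  rw [Finset.sum_comm]
  exact Finset.sum_congr rfl fun β _ => Finset.sum_comm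

end Sums

section Coefficients

variable {g e : ℕ} {E : Type*} [NormedAddCommGroup E] [InnerProductSpace ℂ E]

lemma WXblk_eq_sum {n N : ℕ} (W : List (Fin g) → (EuclideanSpace ℂ (Fin e) →L[ℂ] E))
    (X : Fin g → Matrix (Fin n) (Fin n) ℂ)
    (hX : ∀ α : List (Fin g), N < α.length → wordProd X α = 0) (a i : Fin n) :
    WXblk W X a i = ∑ α ∈ wordsUpTo g N, wordProd X α a i • W α := by
  refine finsum_eq_sum_of_support_subset _ fun α hα => ?_
  by_contra h
  exact hα (by simp [hX α (by simpa using h)])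

lemma GEval_eq_sum {n N : ℕ} (G : List (Fin g) → Matrix (Fin e) (Fin e) ℂ)
    (X : Fin g → Matrix (Fin n) (Fin n) ℂ)
    (hX : ∀ α : List (Fin g), N < α.length → wordProd X α = 0) :
    GEval G X = ∑ α ∈ wordsUpTo g N, G α ⊗ₖ wordProd X α := by
  refine finsum_eq_sum_of_support_subset _ fun α hα => ?_
  by_contra h
  exact hα (by simp [hX α (by simpa using h)])

variable [CompleteSpace E]

/-- The coefficient of `(x^β)^* x^α` in `1 + G(x) + G(x)^*`. -/
noncomputable def leftCoeff (G : List (Fin g) → Matrix (Fin e) (Fin e) ℂ)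
    (β α : List (Fin g)) : EuclideanSpace ℂ (Fin e) →L[ℂ] EuclideanSpace ℂ (Fin e) :=
  (if β = [] then if α = [] then 1 else 0 else 0) +
    (if β = [] then Matrix.toEuclideanCLM (𝕜 := ℂ) (G α) else 0) +
    (if α = [] then Matrix.toEuclideanCLM (𝕜 := ℂ) (G β)ᴴ else 0)

/-- The part of the coefficient of `(x^β)^* x^α` in `W(x)^* L_A(x) W(x)` coming from `A`. -/
noncomputable def rightCoeffA (A : Fin g → (E →L[ℂ] E))
    (W : List (Fin g) → (EuclideanSpace ℂ (Fin e) →L[ℂ] E)) (β : List (Fin g)) :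
    List (Fin g) → EuclideanSpace ℂ (Fin e) →L[ℂ] EuclideanSpace ℂ (Fin e)
  | [] => 0
  | j :: α => adjoint (W β) ∘L A j ∘L W α

/-- The part of the coefficient of `(x^β)^* x^α` in `W(x)^* L_A(x) W(x)` coming from `A^*`. -/
noncomputable def rightCoeffAdj (A : Fin g → (E →L[ℂ] E))
    (W : List (Fin g) → (EuclideanSpace ℂ (Fin e) →L[ℂ] E)) (α : List (Fin g)) :
    List (Fin g) → EuclideanSpace ℂ (Fin e) →L[ℂ] EuclideanSpace ℂ (Fin e)
  | [] => 0
  | k :: β => adjoint (W β) ∘L adjoint (A k) ∘L W α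

/-- The coefficient of `(x^β)^* x^α` in `W(x)^* L_A(x) W(x)`. -/
noncomputable def rightCoeff (A : Fin g → (E →L[ℂ] E))
    (W : List (Fin g) → (EuclideanSpace ℂ (Fin e) →L[ℂ] E)) (β α : List (Fin g)) :
    EuclideanSpace ℂ (Fin e) →L[ℂ] EuclideanSpace ℂ (Fin e) :=
  adjoint (W β) ∘L W α + rightCoeffA A W β α + rightCoeffAdj A W α β

lemma left_eq_sum {n N : ℕ} (G : List (Fin g) → Matrix (Fin e) (Fin e) ℂ)
    (X : Fin g → Matrix (Fin n) (Fin n) ℂ)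
    (hX : ∀ α : List (Fin g), N < α.length → wordProd X α = 0) (i l : Fin n) :
    Matrix.toEuclideanCLM (𝕜 := ℂ)
      (Matrix.of fun a b =>
        ((1 : Matrix (Fin e × Fin n) (Fin e × Fin n) ℂ) + GEval G X + (GEval G X)ᴴ)
          (a, i) (b, l)) =
      ∑ β ∈ wordsUpTo g N, ∑ α ∈ wordsUpTo g N, wordGram X i l β α • leftCoeff G β α := by
  have hmat : (Matrix.of fun a b =>
        ((1 : Matrix (Fin e × Fin n) (Fin e × Fin n) ℂ) + GEval G X + (GEval G X)ᴴ)
          (a, i) (b, l)) =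
      (1 : Matrix (Fin n) (Fin n) ℂ) i l • (1 : Matrix (Fin e) (Fin e) ℂ) +
      ∑ α ∈ wordsUpTo g N, wordProd X α i l • G α +
      ∑ β ∈ wordsUpTo g N, (starRingEnd ℂ) (wordProd X β l i) • (G β)ᴴ := by
    ext a b
    rw [GEval_eq_sum G X hX]
    simp only [Matrix.of_apply, Matrix.add_apply, Matrix.smul_apply, Matrix.sum_apply,
      Matrix.conjTranspose_apply, Matrix.kroneckerMap_apply, Matrix.one_apply, Prod.mk.injEq,
      star_sum, star_mul', smul_eq_mul, starRingEnd_apply, ite_and, mul_ite, mul_one, mul_zero]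
    congr 1
    · congr 1
      · exact Finset.sum_congr rfl fun _ _ => mul_comm _ _
    · exact Finset.sum_congr rfl fun _ _ => mul_comm _ _
  rw [hmat]
  simp only [leftCoeff, smul_add, Finset.sum_add_distrib, smul_ite, smul_zero, map_add, map_sum,
    map_smul, map_one]
  congr 1
  · congr 1
    · simp [wordGram_nil_left]
    · rw [Finset.sum_comm]
      simp [wordGram_nil_left]
  · simp [wordGram_nil_right]

lemma right_eq_sum {n N : ℕ} (A : Fin g → (E →L[ℂ] E))
    (W : List (Fin g) → (EuclideanSpace ℂ (Fin e) →L[ℂ] E))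
    (X : Fin g → Matrix (Fin n) (Fin n) ℂ)
    (hX : ∀ α : List (Fin g), N < α.length → wordProd X α = 0) (i l : Fin n) :
    ∑ a : Fin n, ∑ b : Fin n, adjoint (WXblk W X a i) ∘L (LAblk A X a b) ∘L WXblk W X b l =
      ∑ β ∈ wordsUpTo g N, ∑ α ∈ wordsUpTo g N, wordGram X i l β α • rightCoeff A W β α := by
  have hA : ∀ β, ∑ α ∈ wordsUpTo g N, wordGram X i l β α • rightCoeffA A W β α =
      ∑ α ∈ wordsUpTo g N, ∑ j, wordGram X i l β (j :: α) • (adjoint (W β) ∘L A j ∘L W α) := by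
    intro β
    exact sum_wordsUpTo_smul _ _ (fun α hα => by simp [wordGram, hX α hα]) rfl
  have hAdj : ∀ α, ∑ β ∈ wordsUpTo g N, wordGram X i l β α • rightCoeffAdj A W α β =
      ∑ β ∈ wordsUpTo g N, ∑ k, wordGram X i l (k :: β) α •
        (adjoint (W β) ∘L adjoint (A k) ∘L W α) := by
    intro α
    exact sum_wordsUpTo_smul (wordGram X i l · α) _
      (fun β hβ => by simp [wordGram, hX β hβ]) rfl
  have hR : ∑ β ∈ wordsUpTo g N, ∑ α ∈ wordsUpTo g N, wordGram X i l β α • rightCoeff A W β α =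
      ∑ β ∈ wordsUpTo g N, ∑ α ∈ wordsUpTo g N, (wordGram X i l β α • (adjoint (W β) ∘L W α) +
        ∑ j, wordGram X i l β (j :: α) • (adjoint (W β) ∘L A j ∘L W α) +
        ∑ k, wordGram X i l (k :: β) α • (adjoint (W β) ∘L adjoint (A k) ∘L W α)) := by
    simp only [rightCoeff, smul_add, Finset.sum_add_distrib, hA]
    congr 1
    rw [Finset.sum_comm]
    simp only [hAdj]
    rw [Finset.sum_comm]
  have hL : ∀ a b, adjoint (WXblk W X a i) ∘L (LAblk A X a b) ∘L WXblk W X b l =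
      ∑ β ∈ wordsUpTo g N, ∑ α ∈ wordsUpTo g N,
        ((starRingEnd ℂ) (wordProd X β a i) * wordProd X α b l) •
          (adjoint (W β) ∘L LAblk A X a b ∘L W α) := by
    intro a b
    rw [WXblk_eq_sum W X hX, WXblk_eq_sum W X hX, map_sum]
    ext1 x
    simp only [ContinuousLinearMap.comp_apply, _root_.sum_apply, _root_.smul_apply, map_sum,
      map_smulₛₗ, RingHom.id_apply, Finset.smul_sum, smul_smul]
    rw [Finset.sum_comm]
    simp only [mul_comm]
  have hterm : ∀ β α, ∑ a, ∑ b, ((starRingEnd ℂ) (wordProd X β a i) * wordProd X α b l) •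
          (adjoint (W β) ∘L LAblk A X a b ∘L W α) =
      wordGram X i l β α • (adjoint (W β) ∘L W α) +
        ∑ j, wordGram X i l β (j :: α) • (adjoint (W β) ∘L A j ∘L W α) +
        ∑ k, wordGram X i l (k :: β) α • (adjoint (W β) ∘L adjoint (A k) ∘L W α) := by
    intro β α
    have hblk : ∀ a b, ((starRingEnd ℂ) (wordProd X β a i) * wordProd X α b l) •
          (adjoint (W β) ∘L LAblk A X a b ∘L W α) =
        (if a = b then ((starRingEnd ℂ) (wordProd X β a i) * wordProd X α b l) •
          (adjoint (W β) ∘L W α) else 0) +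
        ∑ j, ((starRingEnd ℂ) (wordProd X β a i) * (X j a b * wordProd X α b l)) •
          (adjoint (W β) ∘L A j ∘L W α) +
        ∑ k, ((starRingEnd ℂ) (wordProd X β a i) *
          ((starRingEnd ℂ) (X k b a) * wordProd X α b l)) •
          (adjoint (W β) ∘L adjoint (A k) ∘L W α) := by
      intro a b
      ext1 x
      rw [LAblk]
      simp only [ContinuousLinearMap.comp_apply, _root_.add_apply,
        _root_.smul_apply, _root_.sum_apply, map_add, map_sum, map_smul,
        smul_add, Finset.smul_sum, smul_smul]
      congr 1
      · congr 1
        · split_ifs <;> simp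
        · exact Finset.sum_congr rfl fun j _ => by congr 1; ring
      · exact Finset.sum_congr rfl fun j _ => by congr 1; ring
    simp only [hblk, Finset.sum_add_distrib]
    rw [sum_sum_sum_smul, sum_sum_sum_smul, wordGram_apply, Finset.sum_smul]
    simp only [wordGram_cons_right, wordGram_cons_left, Finset.sum_ite_eq, Finset.mem_univ,
      if_true]
  rw [hR]
  simp only [hL, ← hterm]
  exact sum_sum_sum_sum_comm _

lemma adjoint_toEuclideanCLM (M : Matrix (Fin e) (Fin e) ℂ) :
    adjoint (Matrix.toEuclideanCLM (𝕜 := ℂ) M) = Matrix.toEuclideanCLM (𝕜 := ℂ) Mᴴ := by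
  rw [← ContinuousLinearMap.star_eq_adjoint, ← Matrix.star_eq_conjTranspose, map_star]

lemma rightCoeff_eq_leftCoeff_iff (A : Fin g → (E →L[ℂ] E))
    (W : List (Fin g) → (EuclideanSpace ℂ (Fin e) →L[ℂ] E))
    (G : List (Fin g) → Matrix (Fin e) (Fin e) ℂ) (hG0 : G [] = 0) :
    (∀ β α, leftCoeff G β α = rightCoeff A W β α) ↔
    ((∀ (α β : List (Fin g)) (j k : Fin g),
        adjoint (W β) ∘L adjoint (A k) ∘L W (j :: α) +
          adjoint (W (k :: β)) ∘L (A j) ∘L W α +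
          adjoint (W (k :: β)) ∘L W (j :: α) = 0) ∧
      (∀ (k : Fin g) (α : List (Fin g)),
        adjoint (W []) ∘L ((A k) ∘L W α + W (k :: α)) =
          Matrix.toEuclideanCLM (𝕜 := ℂ) (G (k :: α))) ∧
      adjoint (W []) ∘L W [] = 1) := by
  constructor
  · intro h
    refine ⟨fun α β j k => ?_, fun k α => ?_, ?_⟩
    · have := h (k :: β) (j :: α)
      simp only [leftCoeff, rightCoeff, rightCoeffA, rightCoeffAdj, reduceCtorEq, if_false,
        add_zero] at this
      rw [this]
      abel
    · have := h [] (k :: α)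
      simp only [leftCoeff, rightCoeff, rightCoeffA, rightCoeffAdj, reduceCtorEq, if_false,
        if_true, add_zero, zero_add] at this
      rw [this, ContinuousLinearMap.comp_add, add_comm]
    · have := h [] []
      simpa [leftCoeff, rightCoeff, rightCoeffA, rightCoeffAdj, hG0] using this.symm
  · rintro ⟨h1, h2, h3⟩ β α
    rcases β with _ | ⟨k, β⟩ <;> rcases α with _ | ⟨j, α⟩
    · simp [leftCoeff, rightCoeff, rightCoeffA, rightCoeffAdj, hG0, h3]
    · simp [leftCoeff, rightCoeff, rightCoeffA, rightCoeffAdj, ← h2, add_comm]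
    · simp only [leftCoeff, rightCoeff, rightCoeffA, rightCoeffAdj, reduceCtorEq, if_false,
        if_true, add_zero, zero_add, ← adjoint_toEuclideanCLM, ← h2]
      simp [ContinuousLinearMap.adjoint_comp, ContinuousLinearMap.comp_add,
        ContinuousLinearMap.comp_assoc, add_comm]
    · simp only [leftCoeff, rightCoeff, rightCoeffA, rightCoeffAdj, reduceCtorEq, if_false,
        add_zero]
      rw [← h1 α β j k]
      abel

end Coefficients

/-- The formal power series identity `I + G(x) + G(x)^* = W(x)^* L_A(x) W(x)`, expressed by
the coefficient identities, holds if and only if the corresponding evaluated identity holds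
at every jointly nilpotent matrix tuple `X` (stated blockwise). -/
theorem coefficient_identities_iff_nilpotent_evaluation {g e : ℕ} (he : 0 < e)
    (E : Type*) [NormedAddCommGroup E] [InnerProductSpace ℂ E] [CompleteSpace E]
    (A : Fin g → (E →L[ℂ] E))
    (W : List (Fin g) → (EuclideanSpace ℂ (Fin e) →L[ℂ] E))
    (G : List (Fin g) → Matrix (Fin e) (Fin e) ℂ)
    (hG0 : G [] = 0) :
    ((∀ (α β : List (Fin g)) (j k : Fin g),
        adjoint (W β) ∘L adjoint (A k) ∘L W (j :: α) +
          adjoint (W (k :: β)) ∘L (A j) ∘L W α +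
          adjoint (W (k :: β)) ∘L W (j :: α) = 0) ∧
      (∀ (k : Fin g) (α : List (Fin g)),
        adjoint (W []) ∘L ((A k) ∘L W α + W (k :: α)) =
          Matrix.toEuclideanCLM (𝕜 := ℂ) (G (k :: α))) ∧
      adjoint (W []) ∘L W [] = 1) ↔
    (∀ (n : ℕ) (X : Fin g → Matrix (Fin n) (Fin n) ℂ),
      (∃ N : ℕ, ∀ α : List (Fin g), N ≤ α.length → wordProd X α = 0) →
      ∀ i l : Fin n,
        Matrix.toEuclideanCLM (𝕜 := ℂ)
          (Matrix.of fun a b =>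
            ((1 : Matrix (Fin e × Fin n) (Fin e × Fin n) ℂ) + GEval G X + (GEval G X)ᴴ)
              (a, i) (b, l)) =
        ∑ a : Fin n, ∑ b : Fin n,
          adjoint (WXblk W X a i) ∘L (LAblk A X a b) ∘L WXblk W X b l) := by
  rw [← rightCoeff_eq_leftCoeff_iff A W G hG0]
  constructor
  · rintro h n X ⟨N, hN⟩ i l
    have hX : ∀ α : List (Fin g), N < α.length → wordProd X α = 0 := fun α hα => hN α hα.le
    rw [left_eq_sum G X hX, right_eq_sum A W X hX]
    simp only [h]
  · intro h β α
    have hX := wordProd_chainTuple_eq_zero β α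
    have key := h _ (chainTuple β α) ⟨_, hX⟩ 0 (Fin.last _)
    rw [left_eq_sum G _ hX, right_eq_sum A W _ hX] at key
    rwa [sum_wordGram_chainTuple_smul, sum_wordGram_chainTuple_smul] at key
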